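/- In the two-diner transition system with the deadlock-escaping strategy 𝔞', every state reachable from ⟨0,0⟩ by 𝔞' can return to ⟨0,0⟩ by 𝔞': for every u : State, Relation.ReflTransGen 𝔞' ⟨0,0⟩ u implies Relation.ReflTransGen 𝔞' u ⟨0,0⟩. -/

import Mathlib

/-- A member: `none` is `0`, `some true` is `a`, `some false` is `b`. -/
abbrev Member : Type := Option Bool

/-- A state records who is holding each of the two chopsticks. -/
abbrev DState : Type := Member × Member

/-- `get_i`: member `i` acquires a chopstick. It holds exactly for the pairs
`(⟨m,0⟩, ⟨m,i⟩)` and `(⟨0,m⟩, ⟨i,m⟩)` for each `m : Member`. -/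
def getRel (i : Bool) : DState → DState → Prop := fun x y =>
  (∃ m : Member, x = (m, none) ∧ y = (m, some i)) ∨
  (∃ m : Member, x = (none, m) ∧ y = (some i, m))

/-- `eat_i`: member `i` eats and puts down both chopsticks; it holds exactly
for the single pair `(⟨i,i⟩, ⟨0,0⟩)`. -/
def eatRel (i : Bool) : DState → DState → Prop := fun x y =>
  x = (some i, some i) ∧ y = (none, none)

/-- `𝔞 := get_a ∪ get_b ∪ eat_a ∪ eat_b`. -/
def aRel : DState → DState → Prop := fun x y =>
  getRel true x y ∨ getRel false x y ∨ eatRel true x y ∨ eatRel false x y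

/-- `𝔞^⊤`: relates a state to itself iff `𝔞` can be applied there. -/
def aTop : DState → DState → Prop := fun x y => x = y ∧ ∃ z, aRel x z

/-- `𝔞^⊥`: relates a state to itself iff `𝔞` cannot be applied there. -/
def aBot : DState → DState → Prop := fun x y => x = y ∧ ¬ ∃ z, aRel x z

/-- `get_b ▷ get_a`: holds at `(x,y)` iff `∃ w, get_b w x ∧ get_a w y`
(i.e. undo a `get_b` and do a `get_a` instead). -/
def bGivesA : DState → DState → Prop := fun x y =>
  ∃ w, getRel false w x ∧ getRel true w y

/-- The deadlock-escaping strategy `𝔞' := (𝔞^⊤ ; 𝔞) ∪ (𝔞^⊥ ; (get_b ▷ get_a))`. -/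
def aRel' : DState → DState → Prop := fun x y =>
  Relation.Comp aTop aRel x y ∨ Relation.Comp aBot bGivesA x y

theorem aRel'_of_aRel {x y : DState} (h : aRel x y) : aRel' x y :=
  Or.inl ⟨x, ⟨rfl, y, h⟩, h⟩

theorem aRel'_get_fst (i : Bool) (m : Member) : aRel' (none, m) (some i, m) := by
  apply aRel'_of_aRel
  cases i
  · exact Or.inr (Or.inl (Or.inr ⟨m, rfl, rfl⟩))
  · exact Or.inl (Or.inr ⟨m, rfl, rfl⟩)

theorem aRel'_get_snd (i : Bool) (m : Member) : aRel' (m, none) (m, some i) := by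
  apply aRel'_of_aRel
  cases i
  · exact Or.inr (Or.inl (Or.inl ⟨m, rfl, rfl⟩))
  · exact Or.inl (Or.inl ⟨m, rfl, rfl⟩)

theorem aRel'_eat (i : Bool) : aRel' (some i, some i) (none, none) := by
  apply aRel'_of_aRel
  cases i
  · exact Or.inr (Or.inr (Or.inr ⟨rfl, rfl⟩))
  · exact Or.inr (Or.inr (Or.inl ⟨rfl, rfl⟩))

theorem not_aRel_of_ne {i j : Bool} (hij : i ≠ j) : ¬ ∃ z, aRel (some i, some j) z := by
  rintro ⟨z, h⟩
  cases i <;> cases j <;> simp_all [aRel, getRel, eatRel]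

/-- When the diners are stuck, `b` yields a chopstick and `a` holds both. -/
theorem aRel'_yield {i j : Bool} (hij : i ≠ j) :
    aRel' (some i, some j) (some true, some true) := by
  refine Or.inr ⟨_, ⟨rfl, not_aRel_of_ne hij⟩, ?_⟩
  cases i <;> cases j
  · exact absurd rfl hij
  · exact ⟨(none, some true), Or.inr ⟨_, rfl, rfl⟩, Or.inr ⟨_, rfl, rfl⟩⟩
  · exact ⟨(some true, none), Or.inl ⟨_, rfl, rfl⟩, Or.inl ⟨_, rfl, rfl⟩⟩
  · exact absurd rfl hij

/-- Every state, reachable or not, can return to the initial state. -/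
theorem reflTransGen_aRel'_initial (u : DState) :
    Relation.ReflTransGen aRel' u (none, none) := by
  obtain ⟨_ | i, _ | j⟩ := u
  · exact .refl
  · exact .head (aRel'_get_fst j _) (.single (aRel'_eat j))
  · exact .head (aRel'_get_snd i _) (.single (aRel'_eat i))
  · by_cases hij : i = j
    · subst hij
      exact .single (aRel'_eat i)
    · exact .head (aRel'_yield hij) (.single (aRel'_eat true))

/-- with the deadlock-escaping strategy `𝔞'`, every state reachable
from `⟨0,0⟩` by `𝔞'` can return to `⟨0,0⟩` by `𝔞'`. -/
theorem diners_no_deadlock (u : DState)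
    (h : Relation.ReflTransGen aRel' (none, none) u) :
    Relation.ReflTransGen aRel' u (none, none) := by
  exact reflTransGen_aRel'_initial u
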